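/- arXiv:2505.21737 — 3 statements merged into one kernel-verified Lean document; each statement's English description precedes it below -/
import Mathlib

section
/- Suppose μ > 4π, λ > μ²/(μ−4π), and μ ≥ λ/2. Set z* = √(2πλμ/(λ−μ)), N₂ = ⌊μ⌋, and N₁ = max{m ∈ [0, z*) ∩ ℤ : ⌊Φ_{λ,μ}(m) + 1/4⌋ = ⌊Φ_{λ,μ}(0) + 1/4⌋}. Then 0 ≤ N₁ < N₂ and ∫_{N₁}^{N₂} Φ_{λ,μ}(z) dz − T(Φ_{λ,μ} + 1/4, N₁, N₂) > (3 − 2√2)μ/8 − (2 − √2)/8. -/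
open Real Set

/-- The trapezoidal floor sum of `g` on `[a,b]`. -/
noncomputable def trapSum (g : ℝ → ℝ) (a b : ℤ) : ℝ :=
  (⌊g a⌋ : ℝ) / 2 + ∑ m ∈ Finset.Ioo a b, (⌊g m⌋ : ℝ) + (⌊g b⌋ : ℝ) / 2

/-- The function `G_λ(z) = (1/π)(√(λ² − z²) − z·arccos(z/λ))` for `z ≤ λ`, and `0` for `z > λ`. -/
noncomputable def funG (lam z : ℝ) : ℝ :=
  if z ≤ lam then (Real.sqrt (lam ^ 2 - z ^ 2) - z * Real.arccos (z / lam)) / π else 0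

/-- The function `Φ_{λ,μ}(z) = G_λ(z) − G_μ(z)`. -/
noncomputable def funPhi (lam mu z : ℝ) : ℝ := funG lam z - funG mu z

lemma hasDerivAt_arccos_div {c x : ℝ} (hx : |x| < c) :
    HasDerivAt (fun y => Real.arccos (y / c))
      (-(1 / Real.sqrt (1 - (x / c) ^ 2)) * (1 / c)) x := by
  have hc : 0 < c := (abs_nonneg x).trans_lt hx
  obtain ⟨h1, h2⟩ := abs_lt.mp hx
  have h := (Real.hasDerivAt_arccos (x := x / c)
    (by rw [Ne, div_eq_iff hc.ne']; linarith)
    (by rw [Ne, div_eq_iff hc.ne']; linarith)).comp x ((hasDerivAt_id x).div_const c)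
  exact h

lemma hasDerivAt_funG {lam z : ℝ} (hz : |z| < lam) :
    HasDerivAt (funG lam) (-(Real.arccos (z / lam) / π)) z := by
  have hlam : 0 < lam := (abs_nonneg z).trans_lt hz
  obtain ⟨hz1, hz2⟩ := abs_lt.mp hz
  have hpos : 0 < lam ^ 2 - z ^ 2 := by nlinarith
  have hs : 0 < Real.sqrt (lam ^ 2 - z ^ 2) := Real.sqrt_pos.mpr hpos
  have hsq : Real.sqrt (1 - (z / lam) ^ 2) = Real.sqrt (lam ^ 2 - z ^ 2) / lam := by
    rw [show 1 - (z / lam) ^ 2 = (lam ^ 2 - z ^ 2) / lam ^ 2 by field_simp,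
      Real.sqrt_div hpos.le, Real.sqrt_sq hlam.le]
  have h1 : HasDerivAt (fun x : ℝ => Real.sqrt (lam ^ 2 - x ^ 2))
      (-z / Real.sqrt (lam ^ 2 - z ^ 2)) z := by
    have h := (((hasDerivAt_id z).pow 2).const_sub (lam ^ 2)).sqrt (by simpa using hpos.ne')
    refine h.congr_deriv ?_
    simp only [id, Pi.pow_apply]
    field_simp
    norm_num
  have h2 : HasDerivAt (fun x : ℝ => Real.arccos (x / lam))
      (-(1 / Real.sqrt (lam ^ 2 - z ^ 2))) z := by
    have h := hasDerivAt_arccos_div hz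
    refine h.congr_deriv ?_
    rw [hsq]
    field_simp
  have h3 := (h1.sub ((hasDerivAt_id z).mul h2)).div_const π
  have h4 : HasDerivAt
      (fun x : ℝ => (Real.sqrt (lam ^ 2 - x ^ 2) - x * Real.arccos (x / lam)) / π)
      (-(Real.arccos (z / lam) / π)) z := by
    refine h3.congr_deriv ?_
    simp only [id]
    ring
  refine h4.congr_of_eventuallyEq ?_
  filter_upwards [Iio_mem_nhds hz2] with x hx
  simp [funG, (mem_Iio.mp hx).le]

lemma continuousOn_funG (lam : ℝ) : ContinuousOn (funG lam) (Iic lam) := by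
  have h : ContinuousOn
      (fun x : ℝ => (Real.sqrt (lam ^ 2 - x ^ 2) - x * Real.arccos (x / lam)) / π)
      (Iic lam) := by
    have := Real.continuous_arccos
    fun_prop
  refine h.congr fun x hx => ?_
  simp [funG, mem_Iic.mp hx]

/-- The derivative of `Φ_{λ,μ}`. -/
noncomputable def slopePhi (lam mu z : ℝ) : ℝ :=
  (Real.arccos (z / mu) - Real.arccos (z / lam)) / π

lemma hasDerivAt_funPhi {lam mu z : ℝ} (h : mu < lam) (hz0 : 0 < z) (hz : z < mu) :
    HasDerivAt (funPhi lam mu) (slopePhi lam mu z) z := by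
  have h1 := hasDerivAt_funG (lam := lam) (z := z) (by rw [abs_of_pos hz0]; linarith)
  have h2 := hasDerivAt_funG (lam := mu) (z := z) (by rw [abs_of_pos hz0]; linarith)
  refine (h1.sub h2).congr_deriv ?_
  rw [slopePhi]
  ring

lemma continuousOn_funPhi {lam mu : ℝ} (h : mu < lam) :
    ContinuousOn (funPhi lam mu) (Icc 0 mu) :=
  ((continuousOn_funG lam).mono fun _ hx => hx.2.trans h.le).sub
    ((continuousOn_funG mu).mono fun _ hx => hx.2)

lemma sub_le_arcsin_sub_arcsin {x y : ℝ} (hx : -1 ≤ x) (hxy : x ≤ y) (hy : y ≤ 1) :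
    y - x ≤ Real.arcsin y - Real.arcsin x := by
  have hm : Monotone fun u : ℝ => u - Real.sin u := by
    refine monotone_of_deriv_nonneg (by fun_prop) fun u => ?_
    have hd : HasDerivAt (fun u : ℝ => u - Real.sin u) (1 - Real.cos u) u :=
      (hasDerivAt_id u).sub (Real.hasDerivAt_sin u)
    rw [hd.deriv]
    linarith [Real.cos_le_one u]
  have h := hm (Real.monotone_arcsin hxy)
  simp only [Real.sin_arcsin hx (hxy.trans hy), Real.sin_arcsin (hx.trans hxy) hy] at h
  linarith

lemma slopePhi_le {lam mu z : ℝ} (hmu : 0 < mu) (h : mu < lam) (hz0 : 0 ≤ z) (hz : z ≤ mu) :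
    slopePhi lam mu z ≤ -((lam - mu) / (π * lam * mu) * z) := by
  have hlam : 0 < lam := hmu.trans h
  have h0 : 0 ≤ z / lam := by positivity
  have h1 := sub_le_arcsin_sub_arcsin (x := z / lam) (y := z / mu) (by linarith)
    (div_le_div_of_nonneg_left hz0 hmu h.le) ((div_le_one hmu).mpr hz)
  have h2 : -((lam - mu) / (π * lam * mu) * z) = -(z / mu - z / lam) / π := by
    field_simp
  rw [slopePhi, h2, Real.arccos_eq_pi_div_two_sub_arcsin, Real.arccos_eq_pi_div_two_sub_arcsin]
  gcongr
  linarith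

lemma antitoneOn_slopePhi {lam mu : ℝ} (hmu : 0 < mu) (h : mu < lam) :
    AntitoneOn (slopePhi lam mu) (Icc 0 mu) := by
  have hlam : 0 < lam := hmu.trans h
  have hd : ∀ x ∈ interior (Icc 0 mu), HasDerivAt (slopePhi lam mu)
      ((-(1 / Real.sqrt (1 - (x / mu) ^ 2)) * (1 / mu) -
        -(1 / Real.sqrt (1 - (x / lam) ^ 2)) * (1 / lam)) / π) x := by
    intro x hx
    rw [interior_Icc] at hx
    obtain ⟨hx0, hx1⟩ := hx
    have habs : |x| < mu := by rwa [abs_of_pos hx0]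
    exact ((hasDerivAt_arccos_div habs).sub (hasDerivAt_arccos_div (habs.trans h))).div_const π
  refine antitoneOn_of_deriv_nonpos (convex_Icc _ _) ?_
    (fun x hx => (hd x hx).differentiableAt.differentiableWithinAt) fun x hx => ?_
  · have := Real.continuous_arccos
    unfold slopePhi
    fun_prop
  · rw [(hd x hx).deriv]
    rw [interior_Icc] at hx
    obtain ⟨hx0, hx1⟩ := hx
    have h1 : x / lam ≤ x / mu := div_le_div_of_nonneg_left hx0.le hmu h.le
    have h2 : x / mu < 1 := (div_lt_one hmu).mpr hx1
    have h3 : 0 < x / lam := by positivity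
    have h4 : 0 < 1 - (x / mu) ^ 2 := by nlinarith
    have h5 : (1 / Real.sqrt (1 - (x / lam) ^ 2)) * (1 / lam) ≤
        (1 / Real.sqrt (1 - (x / mu) ^ 2)) * (1 / mu) := by
      have := Real.sqrt_pos.mpr h4
      gcongr
    refine div_nonpos_of_nonpos_of_nonneg ?_ pi_pos.le
    linarith

lemma neg_third_le_slopePhi {lam mu z : ℝ} (hmu : 0 < mu) (h : mu < lam) (hhalf : lam / 2 ≤ mu)
    (hz0 : 0 ≤ z) (hz : z ≤ mu) : -(1 / 3) ≤ slopePhi lam mu z := by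
  refine le_trans ?_ (antitoneOn_slopePhi hmu h ⟨hz0, hz⟩ ⟨hmu.le, le_rfl⟩ hz)
  have hlam : 0 < lam := hmu.trans h
  have h1 : Real.arccos (mu / lam) ≤ π / 3 := by
    have h2 : Real.arccos (1 / 2) = π / 3 := by
      rw [← Real.cos_pi_div_three, Real.arccos_cos (by positivity) (by linarith [pi_pos])]
    rw [← h2]
    refine Real.arccos_le_arccos ?_
    rw [le_div_iff₀ hlam]
    linarith
  rw [slopePhi, div_self hmu.ne', Real.arccos_one, le_div_iff₀ pi_pos]
  linarith

lemma concaveOn_funPhi {lam mu : ℝ} (hmu : 0 < mu) (h : mu < lam) :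
    ConcaveOn ℝ (Icc 0 mu) (funPhi lam mu) := by
  refine AntitoneOn.concaveOn_of_deriv (convex_Icc _ _) (continuousOn_funPhi h) ?_ ?_
  · intro x hx
    rw [interior_Icc] at hx
    exact (hasDerivAt_funPhi h hx.1 hx.2).differentiableAt.differentiableWithinAt
  · rw [interior_Icc]
    intro x hx y hy hxy
    rw [(hasDerivAt_funPhi h hx.1 hx.2).deriv, (hasDerivAt_funPhi h hy.1 hy.2).deriv]
    exact antitoneOn_slopePhi hmu h (Ioo_subset_Icc_self hx) (Ioo_subset_Icc_self hy) hxy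

lemma antitoneOn_funPhi_add_sq {lam mu : ℝ} (hmu : 0 < mu) (h : mu < lam) :
    AntitoneOn (fun z => funPhi lam mu z + (lam - mu) / (2 * π * lam * mu) * z ^ 2)
      (Icc 0 mu) := by
  have hd : ∀ x ∈ interior (Icc 0 mu), HasDerivAt
      (fun z => funPhi lam mu z + (lam - mu) / (2 * π * lam * mu) * z ^ 2)
      (slopePhi lam mu x + (lam - mu) / (2 * π * lam * mu) * (2 * x)) x := by
    intro x hx
    rw [interior_Icc] at hx
    have h2 : HasDerivAt (fun z : ℝ => z ^ 2) (2 * x) x := by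
      simpa using hasDerivAt_pow 2 x
    exact (hasDerivAt_funPhi h hx.1 hx.2).add (h2.const_mul _)
  refine antitoneOn_of_deriv_nonpos (convex_Icc _ _)
    ((continuousOn_funPhi h).add (by fun_prop))
    (fun x hx => (hd x hx).differentiableAt.differentiableWithinAt) fun x hx => ?_
  rw [(hd x hx).deriv]
  rw [interior_Icc] at hx
  have h1 := slopePhi_le hmu h hx.1.le hx.2.le
  have h2 : (lam - mu) / (2 * π * lam * mu) * (2 * x) = (lam - mu) / (π * lam * mu) * x := by
    have := hmu.trans h
    field_simp
  linarith

lemma antitoneOn_funPhi {lam mu : ℝ} (hmu : 0 < mu) (h : mu < lam) :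
    AntitoneOn (funPhi lam mu) (Icc 0 mu) := by
  intro x hx y hy hxy
  have h1 := antitoneOn_funPhi_add_sq hmu h hx hy hxy
  simp only at h1
  have hlam := hmu.trans h
  have h2 : 0 ≤ (lam - mu) / (2 * π * lam * mu) :=
    div_nonneg (by linarith) (by positivity)
  have h3 : x ^ 2 ≤ y ^ 2 := pow_le_pow_left₀ hx.1 hxy 2
  nlinarith [mul_le_mul_of_nonneg_left h3 h2]

lemma funPhi_sub_le {lam mu : ℝ} (hmu : 0 < mu) (h : mu < lam) (hhalf : lam / 2 ≤ mu)
    {x y : ℝ} (hx : 0 ≤ x) (hxy : x ≤ y) (hy : y ≤ mu) :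
    funPhi lam mu x - funPhi lam mu y ≤ (y - x) / 3 := by
  have hd : ∀ x ∈ interior (Icc 0 mu), HasDerivAt (fun z => funPhi lam mu z + 1 / 3 * z)
      (slopePhi lam mu x + 1 / 3) x := by
    intro x hx
    rw [interior_Icc] at hx
    have h1 : HasDerivAt (fun z : ℝ => 1 / 3 * z) (1 / 3) x := by
      simpa only [id, mul_one] using (hasDerivAt_id x).const_mul (1 / 3 : ℝ)
    exact (hasDerivAt_funPhi h hx.1 hx.2).add h1
  have hm : MonotoneOn (fun z => funPhi lam mu z + 1 / 3 * z) (Icc 0 mu) := by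
    refine monotoneOn_of_deriv_nonneg (convex_Icc _ _)
      ((continuousOn_funPhi h).add (by fun_prop))
      (fun x hx => (hd x hx).differentiableAt.differentiableWithinAt) fun x hx => ?_
    rw [(hd x hx).deriv]
    rw [interior_Icc] at hx
    linarith [neg_third_le_slopePhi hmu h hhalf hx.1.le hx.2.le]
  have h1 := hm ⟨hx, hxy.trans hy⟩ ⟨hx.trans hxy, hy⟩ hxy
  simp only at h1
  linarith

lemma trapSum_eq_sum_Ico (g : ℝ → ℝ) {a b : ℕ} (hab : a < b) :
    trapSum g a b =
      ∑ i ∈ Finset.Ico a b, ((⌊g i⌋ : ℝ) + (⌊g ((i + 1 : ℕ) : ℝ)⌋ : ℝ)) / 2 := by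
  induction b, Nat.succ_le_of_lt hab using Nat.le_induction with
  | base =>
    have h : Finset.Ioo (a : ℤ) ((a.succ : ℕ) : ℤ) = ∅ := by
      ext x
      simp
    simp only [trapSum, h]
    simp
    ring
  | succ b hb ih =>
    have h : Finset.Ioo (a : ℤ) ((b + 1 : ℕ) : ℤ) = insert (b : ℤ) (Finset.Ioo (a : ℤ) b) := by
      ext x
      simp
      omega
    rw [Finset.sum_Ico_succ_top (by omega), ← ih (by omega)]
    simp only [trapSum, h]
    rw [Finset.sum_insert (by simp)]
    simp
    ring

lemma le_integral_of_linear_le {F : ℝ → ℝ} {a b p c : ℝ} (hab : a ≤ b)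
    (hF : ContinuousOn F (Icc a b)) (h : ∀ x ∈ Icc a b, p - c * (x - a) ≤ F x) :
    p * (b - a) - c * (b - a) ^ 2 / 2 ≤ ∫ x in a..b, F x := by
  have h1 : ∫ x in a..b, (p - c * (x - a)) = p * (b - a) - c * (b - a) ^ 2 / 2 := by
    rw [intervalIntegral.integral_sub (by simp)
      (Continuous.intervalIntegrable (by fun_prop) _ _), intervalIntegral.integral_const_mul,
      intervalIntegral.integral_sub (by simp) (by simp), integral_id]
    simp
    ring
  rw [← h1]
  refine intervalIntegral.integral_mono_on hab (Continuous.intervalIntegrable (by fun_prop) _ _)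
    ?_ h
  exact hF.intervalIntegrable_of_Icc hab

/-- On a block where the floor of a concave decreasing `F` drops by one at the first step and then
stays constant, the integral exceeds the trapezoidal floor sum by at least a third of the length,
provided that `F` has slope at least `-1/3`. -/
lemma block_bound {F : ℝ → ℝ} {a b : ℕ} {n : ℤ} (hab : a < b)
    (hF : ContinuousOn F (Icc a b)) (hconc : ConcaveOn ℝ (Icc (a : ℝ) b) F)
    (hlip : ∀ x ∈ Icc (a : ℝ) b, F a - F x ≤ (x - a) / 3)
    (ha : ⌊F a⌋ = n + 1) (hn : ∀ i : ℕ, a < i → i ≤ b → ⌊F i⌋ = n) :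
    ((b : ℝ) - a) / 3 ≤ (∫ x in (a : ℝ)..b, F x) -
      ∑ i ∈ Finset.Ico a b, ((⌊F i⌋ : ℝ) + (⌊F ((i + 1 : ℕ) : ℝ)⌋ : ℝ)) / 2 := by
  have hab' : (a : ℝ) < b := by exact_mod_cast hab
  have hL : (a : ℝ) + 1 ≤ b := by exact_mod_cast hab
  have hsum : ∑ i ∈ Finset.Ico a b, ((⌊F i⌋ : ℝ) + (⌊F ((i + 1 : ℕ) : ℝ)⌋ : ℝ)) / 2 =
      n * ((b : ℝ) - a) + 1 / 2 := by
    rw [Finset.sum_eq_sum_Ico_succ_bot hab, ha, hn (a + 1) (by omega) (by omega)]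
    rw [Finset.sum_congr rfl (g := fun _ => (n : ℝ))]
    · simp [Nat.cast_sub (Nat.succ_le_of_lt hab)]
      ring
    · intro i hi
      rw [Finset.mem_Ico] at hi
      rw [hn i (by omega) (by omega), hn (i + 1) (by omega) (by omega)]
      ring
  have hFa : (n : ℝ) + 1 ≤ F a := by
    have := Int.floor_le (F a)
    rw [ha] at this
    exact_mod_cast this
  have hFb : (n : ℝ) ≤ F b := by
    have := Int.floor_le (F b)
    rwa [hn b hab le_rfl] at this
  rw [hsum]
  rcases le_or_gt 3 (b - a) with h3 | h3
  · have h3' : (3 : ℝ) ≤ (b : ℝ) - a := by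
      rw [← Nat.cast_sub hab.le]
      exact_mod_cast h3
    have hint := le_integral_of_linear_le (p := (n : ℝ) + 1) (c := 1 / ((b : ℝ) - a)) hab'.le hF ?_
    · have : 1 / ((b : ℝ) - a) * ((b : ℝ) - a) ^ 2 = (b : ℝ) - a := by
        field_simp
      rw [this] at hint
      linarith
    · intro x hx
      have hpos : 0 < (b : ℝ) - a := by linarith
      have hc := hconc.2 (left_mem_Icc.mpr hab'.le) (right_mem_Icc.mpr hab'.le)
        (show 0 ≤ ((b : ℝ) - x) / ((b : ℝ) - a) from
          div_nonneg (by linarith [hx.2]) hpos.le)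
        (show 0 ≤ (x - (a : ℝ)) / ((b : ℝ) - a) from
          div_nonneg (by linarith [hx.1]) hpos.le)
        (by field_simp; ring)
      simp only [smul_eq_mul] at hc
      have hxe : ((b : ℝ) - x) / ((b : ℝ) - a) * a + (x - (a : ℝ)) / ((b : ℝ) - a) * b = x := by
        field_simp
        ring
      rw [hxe] at hc
      refine le_trans ?_ hc
      calc (n : ℝ) + 1 - 1 / ((b : ℝ) - a) * (x - a)
          = ((b : ℝ) - x) / ((b : ℝ) - a) * (n + 1) + (x - (a : ℝ)) / ((b : ℝ) - a) * n := by
            field_simp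
            ring
        _ ≤ _ := by
            have := hx.1
            have := hx.2
            gcongr
  · have hint := le_integral_of_linear_le (p := (n : ℝ) + 1) (c := 1 / 3) hab'.le hF ?_
    · have hcases : b = a + 1 ∨ b = a + 2 := by omega
      rcases hcases with rfl | rfl <;> push_cast at hint ⊢ <;> linarith
    · intro x hx
      linarith [hlip x hx]

theorem third_length_le_integral_sub_sum {F : ℝ → ℝ} {a B : ℕ} (haB : a ≤ B)
    (hF : ContinuousOn F (Icc a B)) (hconc : ConcaveOn ℝ (Icc (a : ℝ) B) F)
    (hanti : AntitoneOn F (Icc (a : ℝ) B))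
    (hlip : ∀ x y, (a : ℝ) ≤ x → x ≤ y → y ≤ B → F x - F y ≤ (y - x) / 3)
    (hdrop : a < B → ⌊F ((a + 1 : ℕ) : ℝ)⌋ < ⌊F a⌋) :
    ((B : ℝ) - a) / 3 ≤ (∫ x in (a : ℝ)..B, F x) -
      ∑ i ∈ Finset.Ico a B, ((⌊F i⌋ : ℝ) + (⌊F ((i + 1 : ℕ) : ℝ)⌋ : ℝ)) / 2 := by
  induction hk : B - a using Nat.strong_induction_on generalizing a with
  | _ k ih =>
    rcases haB.eq_or_lt with rfl | hlt
    · simp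
    have hlt' : (a : ℝ) + 1 ≤ B := by exact_mod_cast hlt
    set n : ℤ := ⌊F a⌋ - 1 with hn
    have hmem : ∀ i : ℕ, a ≤ i → i ≤ B → (i : ℝ) ∈ Icc (a : ℝ) B := fun i h1 h2 =>
      ⟨by exact_mod_cast h1, by exact_mod_cast h2⟩
    have hfirst : ⌊F ((a + 1 : ℕ) : ℝ)⌋ = n := by
      have h1 := hdrop hlt
      have h2 : n ≤ ⌊F ((a + 1 : ℕ) : ℝ)⌋ := by
        rw [Int.le_floor]
        have h3 := hlip a ((a + 1 : ℕ) : ℝ) le_rfl (by push_cast; linarith)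
          (by push_cast; linarith)
        have h4 := Int.floor_le (F a)
        rw [hn]
        push_cast at h3 ⊢
        linarith
      omega
    obtain ⟨b, ⟨hb1, hb2, hb3⟩, hbmax⟩ : ∃ b : ℕ, (a < b ∧ b ≤ B ∧ n ≤ ⌊F b⌋) ∧
        ∀ c : ℕ, (a < c ∧ c ≤ B ∧ n ≤ ⌊F c⌋) → c ≤ b := by
      classical
      let s := (Finset.Icc (a + 1) B).filter fun c : ℕ => n ≤ ⌊F c⌋
      have hs : s.Nonempty := ⟨a + 1, by
        simp only [s, Finset.mem_filter, Finset.mem_Icc]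
        exact ⟨⟨le_rfl, hlt⟩, hfirst.ge⟩⟩
      refine ⟨s.max' hs, ?_, fun c hc => s.le_max' c ?_⟩
      · have := s.max'_mem hs
        simp only [s, Finset.mem_filter, Finset.mem_Icc] at this
        exact ⟨this.1.1, this.1.2, this.2⟩
      · simp only [s, Finset.mem_filter, Finset.mem_Icc]
        exact ⟨⟨hc.1, hc.2.1⟩, hc.2.2⟩
    have hfloor : ∀ i : ℕ, a < i → i ≤ b → ⌊F i⌋ = n := by
      intro i h1 h2
      have h3 : ⌊F b⌋ ≤ ⌊F i⌋ := Int.floor_mono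
        (hanti (hmem i h1.le (h2.trans hb2)) (hmem b hb1.le hb2) (by exact_mod_cast h2))
      have h4 : ⌊F i⌋ ≤ ⌊F ((a + 1 : ℕ) : ℝ)⌋ := Int.floor_mono
        (hanti (hmem _ (by omega) hlt) (hmem i h1.le (h2.trans hb2)) (by exact_mod_cast h1))
      omega
    have hbB : (b : ℝ) ≤ B := by exact_mod_cast hb2
    have hab : (a : ℝ) ≤ b := by exact_mod_cast hb1.le
    have hsub1 : Icc (a : ℝ) b ⊆ Icc a B := Icc_subset_Icc_right hbB
    have hsub2 : Icc (b : ℝ) B ⊆ Icc a B := Icc_subset_Icc_left hab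
    have h1 := block_bound hb1 (hF.mono hsub1) (hconc.subset hsub1 (convex_Icc _ _))
      (fun x hx => hlip a x le_rfl hx.1 (hx.2.trans hbB)) (by omega) hfloor
    have h2 := ih (B - b) (by omega) hb2 (hF.mono hsub2)
      (hconc.subset hsub2 (convex_Icc _ _)) (hanti.mono hsub2)
      (fun x y hx => hlip x y (hab.trans hx))
      (fun hbB' => by
        by_contra! hcon
        rw [hfloor b hb1 le_rfl] at hcon
        have := hbmax (b + 1) ⟨by omega, hbB', hcon⟩
        omega) rfl
    rw [← Finset.sum_Ico_consecutive _ hb1.le hb2,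
      ← intervalIntegral.integral_add_adjacent_intervals
        ((hF.mono hsub1).intervalIntegrable_of_Icc hab)
        ((hF.mono hsub2).intervalIntegrable_of_Icc hbB)]
    linarith

theorem regionV_middle_bound (lam mu : ℝ)
    (hmu : 4 * π < mu) (hlam : mu ^ 2 / (mu - 4 * π) < lam) (hhalf : lam / 2 ≤ mu)
    (N₁ : ℤ)
    (hN₁ : IsGreatest {m : ℤ | 0 ≤ m ∧ (m : ℝ) < Real.sqrt (2 * π * lam * mu / (lam - mu)) ∧
      ⌊funPhi lam mu m + 1 / 4⌋ = ⌊funPhi lam mu 0 + 1 / 4⌋} N₁) :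
    0 ≤ N₁ ∧ N₁ < ⌊mu⌋ ∧
    (∫ z in ((N₁ : ℝ))..((⌊mu⌋ : ℝ)), funPhi lam mu z) -
        trapSum (fun z => funPhi lam mu z + 1 / 4) N₁ ⌊mu⌋ >
      (3 - 2 * Real.sqrt 2) * mu / 8 - (2 - Real.sqrt 2) / 8 := by
  have hpi := pi_gt_three
  have hmu0 : 0 < mu := by linarith
  have hprod : mu ^ 2 < lam * (mu - 4 * π) := (div_lt_iff₀ (by linarith)).mp hlam
  have hlam0 : 0 < lam := lt_trans (div_pos (by positivity) (by linarith)) hlam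
  have hml : mu < lam := by nlinarith
  have hmu24 : 24 < mu := by nlinarith
  obtain ⟨⟨hN0, hNlt, hNfl⟩, hNmax⟩ := hN₁
  set zs := Real.sqrt (2 * π * lam * mu / (lam - mu)) with hzs
  have hdpos : 0 < lam - mu := by linarith
  have hzs_sq : zs ^ 2 = 2 * π * lam * mu / (lam - mu) :=
    Real.sq_sqrt (div_nonneg (by positivity) hdpos.le)
  have hr2 : Real.sqrt 2 ^ 2 = 2 := Real.sq_sqrt (by norm_num)
  have hr0 : 0 ≤ Real.sqrt 2 := Real.sqrt_nonneg 2
  have hr1 : 1.4 < Real.sqrt 2 := Real.lt_sqrt_of_sq_lt (by norm_num)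
  have hr3 : Real.sqrt 2 < 1.42 := by
    rw [Real.sqrt_lt' (by norm_num)]
    norm_num
  have hzs_lt : zs < Real.sqrt 2 / 2 * mu := by
    refine lt_of_pow_lt_pow_left₀ 2 (by positivity) ?_
    rw [hzs_sq, mul_pow, div_pow, hr2, div_lt_iff₀ hdpos]
    nlinarith
  have hfl := Int.lt_floor_add_one mu
  have hfl2 := Int.floor_le mu
  have hN1N2 : (N₁ : ℝ) + 1 < ⌊mu⌋ := by nlinarith
  have hlt : N₁ < ⌊mu⌋ := by
    have : N₁ + 1 < ⌊mu⌋ := by exact_mod_cast hN1N2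
    omega
  refine ⟨hN0, hlt, ?_⟩
  set F : ℝ → ℝ := fun z => funPhi lam mu z + 1 / 4 with hFdef
  have hN0' : (0 : ℝ) ≤ N₁ := by exact_mod_cast hN0
  have hdrop : ⌊F (N₁ + 1)⌋ < ⌊F N₁⌋ := by
    have hanti : F (N₁ + 1) ≤ F N₁ := by
      have := antitoneOn_funPhi hmu0 hml (a := (N₁ : ℝ)) (b := N₁ + 1) ⟨hN0', by linarith⟩
        ⟨by linarith, by linarith⟩ (by linarith)
      simp only [hFdef]
      linarith
    refine lt_of_le_of_ne (Int.floor_mono hanti) fun heq => ?_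
    have hge : zs ≤ N₁ + 1 := by
      by_contra! hcon
      have := hNmax (a := N₁ + 1) ⟨by omega, by push_cast; exact hcon, by
        push_cast
        exact heq.trans hNfl⟩
      omega
    have hq := antitoneOn_funPhi_add_sq hmu0 hml (a := 0) (b := (N₁ : ℝ) + 1) ⟨le_rfl, hmu0.le⟩
        ⟨by linarith, by linarith⟩ (by linarith)
    simp only at hq
    have hone : (lam - mu) / (2 * π * lam * mu) * zs ^ 2 = 1 := by
      rw [hzs_sq]
      field_simp
    have hle : (lam - mu) / (2 * π * lam * mu) * zs ^ 2 ≤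
        (lam - mu) / (2 * π * lam * mu) * ((N₁ : ℝ) + 1) ^ 2 := by
      have : 0 ≤ zs := Real.sqrt_nonneg _
      have : 0 ≤ (lam - mu) / (2 * π * lam * mu) := div_nonneg hdpos.le (by positivity)
      gcongr
    have h1 : F (N₁ + 1) ≤ F 0 - 1 := by
      simp only [hFdef]
      norm_num at hq
      linarith
    have h2 : ⌊F (N₁ + 1)⌋ ≤ ⌊F 0 - 1⌋ := Int.floor_mono h1
    rw [Int.floor_sub_one, heq, show ⌊F N₁⌋ = ⌊F 0⌋ from hNfl] at h2
    omega
  generalize ⌊mu⌋ = N₂ at *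
  lift N₁ to ℕ using hN0
  lift N₂ to ℕ using by omega
  have hab : N₁ < N₂ := by exact_mod_cast hlt
  simp only [Int.cast_natCast] at *
  have hsub : Icc (N₁ : ℝ) N₂ ⊆ Icc 0 mu := Icc_subset_Icc hN0' hfl2
  have hFc : ContinuousOn F (Icc (N₁ : ℝ) N₂) :=
    ((continuousOn_funPhi hml).mono hsub).add continuousOn_const
  have hmain := third_length_le_integral_sub_sum (F := F) hab.le hFc
    (((concaveOn_funPhi hmu0 hml).subset hsub (convex_Icc _ _)).add_const _)
    (fun x hx y hy hxy => by
      simpa [hFdef] using antitoneOn_funPhi hmu0 hml (hsub hx) (hsub hy) hxy)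
    (fun x y hx hxy hy => by
      have := funPhi_sub_le hmu0 hml hhalf (hN0'.trans hx) hxy (hy.trans hfl2)
      simp only [hFdef]
      linarith)
    (fun _ => by push_cast; exact hdrop)
  rw [← trapSum_eq_sum_Ico F hab] at hmain
  have hint : ∫ x in (N₁ : ℝ)..N₂, F x =
      (∫ x in (N₁ : ℝ)..N₂, funPhi lam mu x) + ((N₂ : ℝ) - N₁) / 4 := by
    rw [intervalIntegral.integral_add
      (((continuousOn_funPhi hml).mono hsub).intervalIntegrable_of_Icc (by exact_mod_cast hab.le))
      (by simp)]
    simp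
    ring
  rw [hint] at hmain
  nlinarith
end

section
/- The set ΛM \ (ΛM_I ∪ ΛM_II ∪ ΛM_III ∪ ΛM_IV ∪ ΛM_V) is contained in the bounded region ΛM_comp = {(λ,μ) : 5/2 ≤ λ ≤ 150, 0 ≤ μ ≤ (22/25)λ}. -/
open Real Set

/-- The curved pieces of `ζ_II`: `λ − (iπ/(2λ))(√(4λ² + i²π²) − iπ)`. -/
noncomputable def curveII (i : ℕ) (lam : ℝ) : ℝ :=
  lam - ((i : ℝ) * π / (2 * lam)) * (Real.sqrt (4 * lam ^ 2 + (i : ℝ) ^ 2 * π ^ 2) - (i : ℝ) * π)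

/-- The function `ζ_II`, defined piecewise:
`ζ_II(λ) = λ − (iπ/(2λ))(√(4λ² + i²π²) − iπ)` if `iπ√r_{i−1}/(1−r_{i−1}) ≤ λ < iπ√r_i/(1−r_i)`
for `i = 1,…,5`, and `ζ_II(λ) = r_iλ` if `iπ√r_i/(1−r_i) ≤ λ < (i+1)π√r_i/(1−r_i)` for
`i = 1,…,4`, where `r₀ = 0, r₁ = 2/3, r₂ = 4/5, r₃ = 17/20, r₄ = 22/25, r₅ = 1`. -/
noncomputable def zetaII (lam : ℝ) : ℝ :=
  if lam < 1 * π * Real.sqrt (2 / 3) / (1 - 2 / 3) then curveII 1 lam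
  else if lam < 2 * π * Real.sqrt (2 / 3) / (1 - 2 / 3) then (2 / 3) * lam
  else if lam < 2 * π * Real.sqrt (4 / 5) / (1 - 4 / 5) then curveII 2 lam
  else if lam < 3 * π * Real.sqrt (4 / 5) / (1 - 4 / 5) then (4 / 5) * lam
  else if lam < 3 * π * Real.sqrt (17 / 20) / (1 - 17 / 20) then curveII 3 lam
  else if lam < 4 * π * Real.sqrt (17 / 20) / (1 - 17 / 20) then (17 / 20) * lam
  else if lam < 4 * π * Real.sqrt (22 / 25) / (1 - 22 / 25) then curveII 4 lam
  else if lam < 5 * π * Real.sqrt (22 / 25) / (1 - 22 / 25) then (22 / 25) * lam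
  else curveII 5 lam

/-- `ΛM = {(λ,μ) : 0 < μ < λ}`. -/
def regLM : Set (ℝ × ℝ) := {p | 0 < p.2 ∧ p.2 < p.1}

/-- `ΛM_I`. -/
noncomputable def regLMI : Set (ℝ × ℝ) :=
  {p | 0 < p.2 ∧ p.2 < p.1 ∧ p.1 ≤ 2 * Real.sqrt 2} ∪
  {p | 2 * Real.sqrt 2 < p.1 ∧ Real.sqrt (p.1 ^ 2 - 8) ≤ p.2 ∧ p.2 < p.1}

/-- `ΛM_II = {(λ,μ) : ζ_II(λ) < μ < λ}`. -/
noncomputable def regLMII : Set (ℝ × ℝ) := {p | zetaII p.1 < p.2 ∧ p.2 < p.1}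

/-- `ΛM_III`. -/
noncomputable def regLMIII : Set (ℝ × ℝ) :=
  {p | 10 < p.1 ∧ 0 < p.2 ∧ p.2 ≤ Real.sqrt (p.1 / 5 - 2)}

/-- `ΛM_IV`. -/
def regLMIV : Set (ℝ × ℝ) :=
  {p | 578 / 45 ≤ p.1 ∧ 64 / 225 ≤ p.2 ∧ p.2 ≤ p.1 / 10 - 1}

/-- `ΛM_V`. -/
noncomputable def regLMV : Set (ℝ × ℝ) :=
  {p | 16 * π < p.1 ∧ (p.1 - Real.sqrt (p.1 * (p.1 - 16 * π))) / 2 < p.2 ∧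
    p.2 < (p.1 + Real.sqrt (p.1 * (p.1 - 16 * π))) / 2}

/-- `ΛM_comp = {(λ,μ) : 5/2 ≤ λ ≤ 150, 0 ≤ μ ≤ (22/25)λ}`. -/
def regLMcomp : Set (ℝ × ℝ) :=
  {p | 5 / 2 ≤ p.1 ∧ p.1 ≤ 150 ∧ 0 ≤ p.2 ∧ p.2 ≤ (22 / 25) * p.1}

theorem curveII_le_mul {i : ℕ} {r lam : ℝ} (hlam : 0 < lam) (hi : 0 < i) (hr0 : 0 ≤ r)
    (hr1 : r < 1) (h : lam < (i : ℝ) * π * √r / (1 - r)) : curveII i lam ≤ r * lam := by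
  have ha : 0 < (i : ℝ) * π := by positivity
  rw [curveII, show (i : ℝ) ^ 2 * π ^ 2 = ((i : ℝ) * π) ^ 2 by ring]
  generalize (i : ℝ) * π = a at ha h ⊢
  rw [lt_div_iff₀ (by linarith)] at h
  have hs := Real.sq_sqrt hr0
  have hsq : (lam * (1 - r)) ^ 2 ≤ a ^ 2 * r := by
    have := pow_le_pow_left₀ (by nlinarith : 0 ≤ lam * (1 - r)) h.le 2
    rwa [mul_pow a, hs] at this
  have key : a + 2 * (1 - r) * lam ^ 2 / a ≤ √(4 * lam ^ 2 + a ^ 2) := by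
    apply Real.le_sqrt_of_sq_le
    have h1 : (lam * (1 - r)) ^ 2 / a ^ 2 ≤ r := by
      rw [div_le_iff₀ (by positivity)]; linarith
    have h2 : (a + 2 * (1 - r) * lam ^ 2 / a) ^ 2
        = a ^ 2 + 4 * (1 - r) * lam ^ 2 + 4 * lam ^ 2 * ((lam * (1 - r)) ^ 2 / a ^ 2) := by
      field_simp
      ring
    rw [h2]
    nlinarith [mul_le_mul_of_nonneg_left h1 (by positivity : 0 ≤ 4 * lam ^ 2)]
  have h3 : a / (2 * lam) * (2 * (1 - r) * lam ^ 2 / a) = (1 - r) * lam := by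
    field_simp
  have h4 := mul_le_mul_of_nonneg_left (sub_le_sub_right key a)
    (by positivity : 0 ≤ a / (2 * lam))
  rw [add_sub_cancel_left, h3] at h4
  linarith

theorem zetaII_le_mul {lam : ℝ} (hlam : 0 < lam)
    (h : lam < 5 * π * √(22 / 25) / (1 - 22 / 25)) : zetaII lam ≤ 22 / 25 * lam := by
  unfold zetaII
  split_ifs with h1 h2 h3 h4 h5 h6 h7
  · have := curveII_le_mul (i := 1) (r := 2 / 3) hlam one_pos (by norm_num) (by norm_num)
      (by exact_mod_cast h1)
    linarith
  · linarith
  · have := curveII_le_mul (i := 2) (r := 4 / 5) hlam two_pos (by norm_num) (by norm_num)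
      (by exact_mod_cast h3)
    linarith
  · linarith
  · have := curveII_le_mul (i := 3) (r := 17 / 20) hlam three_pos (by norm_num) (by norm_num)
      (by exact_mod_cast h5)
    linarith
  · linarith
  · exact curveII_le_mul (i := 4) hlam four_pos (by norm_num) (by norm_num) (by exact_mod_cast h7)
  · exact le_rfl

theorem zetaII_eq_curveII_five {lam : ℝ} (h : 5 * π * √(22 / 25) / (1 - 22 / 25) ≤ lam) :
    zetaII lam = curveII 5 lam := by
  have hpi := Real.pi_pos
  have key : ∀ {k r : ℝ}, 0 ≤ k → k ≤ 5 → r ≤ 22 / 25 →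
      ¬ lam < k * π * √r / (1 - r) := by
    intro k r hk hk5 hr
    refine not_lt.mpr (le_trans ?_ h)
    gcongr
  unfold zetaII
  iterate 8 rw [if_neg (key (by norm_num) (by norm_num) (by norm_num))]

theorem curveII_five_lt {lam : ℝ} (h : 120 ≤ lam) : curveII 5 lam < lam - 147 / 10 := by
  have hpi := Real.pi_gt_d4
  have hpi' := Real.pi_lt_d4
  simp only [curveII, Nat.cast_ofNat]
  rw [show (5 : ℝ) ^ 2 * π ^ 2 = (5 * π) ^ 2 by ring]
  have ha : (157 / 10 : ℝ) < 5 * π := by linarith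
  generalize 5 * π = a at ha ⊢
  have ha0 : 0 < a := by linarith
  have key : a + 2 * lam * (147 / 10) / a < √(4 * lam ^ 2 + a ^ 2) := by
    apply Real.lt_sqrt_of_sq_lt
    have h2 : (a + 2 * lam * (147 / 10) / a) ^ 2
        = a ^ 2 + 4 * lam * (147 / 10) + 4 * lam ^ 2 * ((147 / 10) ^ 2 / a ^ 2) := by
      field_simp
      ring
    have h3 : (147 / 10) ^ 2 / a ^ 2 < (147 / 10 : ℝ) ^ 2 / (157 / 10) ^ 2 := by
      gcongr
    rw [h2]
    nlinarith [mul_lt_mul_of_pos_left h3 (by positivity : 0 < 4 * lam ^ 2)]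
  have h3 : a / (2 * lam) * (2 * lam * (147 / 10) / a) = 147 / 10 := by
    field_simp
  have h4 := mul_lt_mul_of_pos_left (sub_lt_sub_right key a)
    (by positivity : 0 < a / (2 * lam))
  rw [add_sub_cancel_left, h3] at h4
  linarith

theorem mem_regLMV_of_lt_mul {p : ℝ × ℝ} (hp : 16 * π < p.1)
    (h : 4 * π * p.1 < p.2 * (p.1 - p.2)) : p ∈ regLMV := by
  have hsq : (2 * p.2 - p.1) ^ 2 < p.1 * (p.1 - 16 * π) := by nlinarith
  have h1 := abs_lt.mp (Real.lt_sqrt_of_sq_lt (by rwa [sq_abs] : |2 * p.2 - p.1| ^ 2 < _))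
  exact ⟨hp, by linarith, by linarith⟩

theorem remainder_region_bounded :
    regLM \ (regLMI ∪ regLMII ∪ regLMIII ∪ regLMIV ∪ regLMV) ⊆ regLMcomp := by
  rintro ⟨lam, mu⟩ ⟨⟨hmu, hlt⟩, hn⟩
  simp only [mem_union, not_or] at hn
  obtain ⟨⟨⟨⟨hI, hII⟩, hIII⟩, hIV⟩, hV⟩ := hn
  simp only at hmu hlt
  have hlo : 5 / 2 ≤ lam := by
    by_contra! hc
    refine hI (Or.inl ⟨hmu, hlt, ?_⟩)
    have : 5 / 4 ≤ √2 := Real.le_sqrt_of_sq_le (by norm_num)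
    simp only
    linarith
  have hzeta : mu ≤ zetaII lam := not_lt.mp fun hc => hII ⟨hc, hlt⟩
  have hpi := Real.pi_gt_d4
  have hpi' := Real.pi_lt_d4
  rcases lt_or_ge lam (5 * π * √(22 / 25) / (1 - 22 / 25)) with hc | hc
  · refine ⟨hlo, ?_, hmu.le, hzeta.trans (zetaII_le_mul (by linarith) hc)⟩
    have h1 : √(22 / 25) ≤ 1 := Real.sqrt_le_one.mpr (by norm_num)
    rw [lt_div_iff₀ (by norm_num)] at hc
    simp only
    nlinarith
  · have hlam : 120 ≤ lam := by
      have h1 : 0.93 ≤ √(22 / 25) := Real.le_sqrt_of_sq_le (by norm_num)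
      rw [div_le_iff₀ (by norm_num)] at hc
      nlinarith
    rw [zetaII_eq_curveII_five hc] at hzeta
    have ht := curveII_five_lt hlam
    have hprod : mu * (lam - mu) ≤ 4 * π * lam :=
      not_lt.mp fun h => hV (mem_regLMV_of_lt_mul (by simp only; linarith) h)
    have hprod' : mu * (lam - mu) ≤ 12.5664 * lam := by nlinarith
    have hmu_lt : mu < 147 / 10 := by
      by_contra! h
      nlinarith
    refine ⟨hlo, ?_, hmu.le, by simp only; linarith⟩
    by_contra! hbig
    simp only at hbig
    have hmu_lt' : mu < 139 / 10 := by
      by_contra! h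
      nlinarith
    rcases le_or_gt (64 / 225) mu with h | h
    · exact hIV ⟨by simp only; linarith, h, by simp only; linarith⟩
    · exact hIII ⟨by simp only; linarith, hmu, Real.le_sqrt_of_sq_le (by simp only; nlinarith)⟩
end

section
/- Let 0 < μ₀ < λ₀ and set p₀ = 𝒫(λ₀,μ₀). (i) If p₀ = 0, then 𝒫(λ,μ) < (λ² − μ²)/4 for all (λ,μ) with 0 < λ ≤ λ₀ and μ₀ ≤ μ < λ. (ii) If (λ₀² − μ₀²)/4 − p₀ > 0, then 𝒫(λ,μ) < (λ² − μ²)/4 for all (λ,μ) with √(μ₀² + 4p₀) < λ ≤ λ₀ and μ₀ ≤ μ < √(λ² − 4p₀). -/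
open Real Set

/-- The function `H_μ(z) = (3μ² + 2z²)/(24π(μ² − z²)^{3/2})` for `z < μ`. -/
noncomputable def funH (mu z : ℝ) : ℝ :=
  (3 * mu ^ 2 + 2 * z ^ 2) / (24 * π * (mu ^ 2 - z ^ 2) ^ ((3 : ℝ) / 2))

/-- The function `F_μ(z) = max{G_μ(z) − H_μ(z), −1/4}` for `z < μ`, and `−1/4` for `z ≥ μ`. -/
noncomputable def funF (mu z : ℝ) : ℝ :=
  if z < mu then max (funG mu z - funH mu z) (-(1 / 4)) else -(1 / 4)

/-- `𝒫(λ,μ) = 2·T(G_λ − F_μ, 0, ⌊λ⌋+1)`. -/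
noncomputable def funP (lam mu : ℝ) : ℝ :=
  2 * trapSum (fun z => funG lam z - funF mu z) 0 (⌊lam⌋ + 1)

/-- Concavity of the sine on `[0, π]`: its chord slope dominates the slope at the right end. -/
theorem cos_mul_sub_le_sin_sub_sin {a b : ℝ} (ha : 0 ≤ a) (hab : a ≤ b) (hb : b ≤ π) :
    Real.cos b * (b - a) ≤ Real.sin b - Real.sin a := by
  rcases hab.eq_or_lt with rfl | hlt
  · simp
  obtain ⟨c, hc, h⟩ := exists_hasDerivAt_eq_slope Real.sin Real.cos hlt
    Real.continuous_sin.continuousOn (fun x _ => Real.hasDerivAt_sin x)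
  rw [eq_div_iff (sub_pos.2 hlt).ne'] at h
  rw [← h]
  exact mul_le_mul_of_nonneg_right
    (Real.cos_le_cos_of_nonneg_of_le_pi (ha.trans hc.1.le) hb hc.2.le) (sub_pos.2 hlt).le

theorem funG_eq_sin {l z : ℝ} (hl : 0 < l) (h : z ≤ l) :
    funG l z = (l * Real.sin (Real.arccos (z / l)) - z * Real.arccos (z / l)) / π := by
  have hs : Real.sqrt (l ^ 2 - z ^ 2) = l * Real.sqrt (1 - (z / l) ^ 2) := by
    rw [show l ^ 2 - z ^ 2 = l ^ 2 * (1 - (z / l) ^ 2) by field_simp,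
      Real.sqrt_mul (sq_nonneg l), Real.sqrt_sq hl.le]
  rw [funG, if_pos h, Real.sin_arccos, hs]

/-- On `[0, l]`, the angle `arccos (z / l)` maximizes `θ ↦ l sin θ - z θ`. -/
theorem le_funG {l z a : ℝ} (hl : 0 < l) (hz : 0 ≤ z) (h : z ≤ l) (ha : 0 ≤ a)
    (hal : a ≤ Real.arccos (z / l)) : (l * Real.sin a - z * a) / π ≤ funG l z := by
  rw [funG_eq_sin hl h]
  have h1 := cos_mul_sub_le_sin_sub_sin ha hal (Real.arccos_le_pi _)
  rw [Real.cos_arccos (by linarith [div_nonneg hz hl.le]) ((div_le_one hl).2 h)] at h1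
  have h2 := mul_le_mul_of_nonneg_left h1 hl.le
  have h3 : l * (z / l * (Real.arccos (z / l) - a)) = z * (Real.arccos (z / l) - a) := by
    field_simp
  rw [h3] at h2
  exact div_le_div_of_nonneg_right (by linarith) Real.pi_pos.le

theorem funG_nonneg {l z : ℝ} (hl : 0 < l) (hz : 0 ≤ z) : 0 ≤ funG l z := by
  by_cases h : z ≤ l
  · simpa using le_funG hl hz h le_rfl (Real.arccos_nonneg _)
  · simp [funG, h]

theorem funG_mono {l L z : ℝ} (hl : 0 < l) (hL : l ≤ L) (hz : 0 ≤ z) : funG l z ≤ funG L z := by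
  by_cases h : z ≤ l
  · have ha : Real.arccos (z / l) ≤ Real.arccos (z / L) :=
      Real.arccos_le_arccos (div_le_div_of_nonneg_left hz hl hL)
    refine le_trans ?_ (le_funG (hl.trans_le hL) hz (h.trans hL) (Real.arccos_nonneg _) ha)
    rw [funG_eq_sin hl h]
    have := mul_le_mul_of_nonneg_right hL
      (Real.sin_nonneg_of_nonneg_of_le_pi (Real.arccos_nonneg (z / l)) (Real.arccos_le_pi _))
    exact div_le_div_of_nonneg_right (by linarith) Real.pi_pos.le
  · have : funG l z = 0 := by simp [funG, h]
    rw [this]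
    exact funG_nonneg (hl.trans_le hL) hz

theorem funH_eq_sqrt {m z : ℝ} (hz : 0 ≤ z) (h : z < m) :
    funH m z = (3 * Real.sqrt (m ^ 2 - z ^ 2) ^ 2 + 5 * z ^ 2) /
      (24 * π * Real.sqrt (m ^ 2 - z ^ 2) ^ 3) := by
  have hu : 0 ≤ m ^ 2 - z ^ 2 := by nlinarith
  rw [funH, Real.rpow_div_two_eq_sqrt _ hu, Real.sq_sqrt hu]
  congr 1
  · ring
  · norm_cast

theorem funH_nonneg {m z : ℝ} (hz : 0 ≤ z) (h : z < m) : 0 ≤ funH m z := by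
  rw [funH_eq_sqrt hz h]
  positivity

theorem funH_anti {m M z : ℝ} (hz : 0 ≤ z) (h : z < m) (hM : m ≤ M) : funH M z ≤ funH m z := by
  rw [funH_eq_sqrt hz h, funH_eq_sqrt hz (h.trans_le hM)]
  have hs : 0 < Real.sqrt (m ^ 2 - z ^ 2) := Real.sqrt_pos.2 (by nlinarith)
  have hst : Real.sqrt (m ^ 2 - z ^ 2) ≤ Real.sqrt (M ^ 2 - z ^ 2) :=
    Real.sqrt_le_sqrt (by nlinarith)
  generalize Real.sqrt (m ^ 2 - z ^ 2) = s at *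
  generalize Real.sqrt (M ^ 2 - z ^ 2) = t at *
  have ht : 0 < t := hs.trans_le hst
  rw [div_le_div_iff₀ (by positivity) (by positivity)]
  have h1 : s ^ 2 * t ^ 2 * s ≤ s ^ 2 * t ^ 2 * t := by gcongr
  have h2 : z ^ 2 * s ^ 3 ≤ z ^ 2 * t ^ 3 := by gcongr
  have h3 : 24 * π * (3 * (s ^ 2 * t ^ 2 * s) + 5 * (z ^ 2 * s ^ 3)) ≤
      24 * π * (3 * (s ^ 2 * t ^ 2 * t) + 5 * (z ^ 2 * t ^ 3)) :=
    mul_le_mul_of_nonneg_left (by linarith) (by positivity)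
  linarith

theorem neg_quarter_le_funF (m z : ℝ) : -(1 / 4) ≤ funF m z := by
  unfold funF
  split_ifs
  · exact le_max_right _ _
  · exact le_rfl

theorem funF_mono {m M z : ℝ} (hz : 0 ≤ z) (hm : 0 < m) (hM : m ≤ M) : funF m z ≤ funF M z := by
  by_cases h : z < m
  · rw [funF, funF, if_pos h, if_pos (h.trans_le hM)]
    exact max_le_max (sub_le_sub (funG_mono hm hM hz) (funH_anti hz h hM)) le_rfl
  · rw [show funF m z = -(1 / 4) by rw [funF, if_neg h]]
    exact neg_quarter_le_funF M z

theorem funF_le_funG {m l z : ℝ} (hz : 0 ≤ z) (hm : 0 < m) (hl : m ≤ l) :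
    funF m z ≤ funG l z := by
  have h0 := funG_nonneg (hm.trans_le hl) hz
  unfold funF
  split_ifs with h
  · exact max_le (by linarith [funG_mono hm hl hz, funH_nonneg hz h]) (by linarith)
  · linarith

theorem funP_eq {l m : ℝ} (hml : m ≤ l) :
    funP l m = (⌊funG l 0 - funF m 0⌋ : ℝ) +
      2 * ∑ k ∈ Finset.Ioo (0 : ℤ) (⌊l⌋ + 1), (⌊funG l k - funF m k⌋ : ℝ) := by
  have hlt : l < ((⌊l⌋ + 1 : ℤ) : ℝ) := by
    push_cast
    exact Int.lt_floor_add_one l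
  have hG : funG l ((⌊l⌋ + 1 : ℤ) : ℝ) = 0 := by rw [funG, if_neg hlt.not_ge]
  have hF : funF m ((⌊l⌋ + 1 : ℤ) : ℝ) = -(1 / 4) := by
    rw [funF, if_neg (hml.trans hlt.le).not_gt]
  have hfl : ⌊(0 : ℝ) - -(1 / 4)⌋ = 0 := by
    rw [Int.floor_eq_zero_iff]
    constructor <;> norm_num
  simp only [funP, trapSum]
  rw [hG, hF, hfl, Int.cast_zero (R := ℝ)]
  ring

theorem funP_nonneg {l m : ℝ} (hm : 0 < m) (hml : m ≤ l) : 0 ≤ funP l m := by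
  rw [funP_eq hml]
  have key : ∀ z : ℝ, 0 ≤ z → (0 : ℝ) ≤ (⌊funG l z - funF m z⌋ : ℝ) := fun z hz => by
    exact_mod_cast Int.floor_nonneg.2 (sub_nonneg.2 (funF_le_funG hz hm hml))
  have hs := Finset.sum_nonneg (s := Finset.Ioo (0 : ℤ) (⌊l⌋ + 1)) fun k hk =>
    key k (by exact_mod_cast (Finset.mem_Ioo.1 hk).1.le)
  linarith [key 0 le_rfl]

/-- `𝒫(λ,μ)` is nondecreasing in `λ` and nonincreasing in `μ`. -/
theorem funP_le_funP {l m L M : ℝ} (hm : 0 < m) (hmM : m ≤ M) (hMl : M ≤ l) (hlL : l ≤ L) :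
    funP l M ≤ funP L m := by
  have hM := hm.trans_le hmM
  have hl := hM.trans_le hMl
  rw [funP_eq hMl, funP_eq (hmM.trans (hMl.trans hlL))]
  have key : ∀ z : ℝ, 0 ≤ z →
      (⌊funG l z - funF M z⌋ : ℝ) ≤ (⌊funG L z - funF m z⌋ : ℝ) := fun z hz => by
    exact_mod_cast Int.floor_le_floor (sub_le_sub (funG_mono hl hlL hz) (funF_mono hz hm hmM))
  have h1 := Finset.sum_le_sum (s := Finset.Ioo (0 : ℤ) (⌊l⌋ + 1)) fun k hk =>
    key k (by exact_mod_cast (Finset.mem_Ioo.1 hk).1.le)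
  have hsub : Finset.Ioo (0 : ℤ) (⌊l⌋ + 1) ⊆ Finset.Ioo (0 : ℤ) (⌊L⌋ + 1) :=
    Finset.Ioo_subset_Ioo_right (by linarith [Int.floor_le_floor hlL])
  have h2 := Finset.sum_le_sum_of_subset_of_nonneg
    (f := fun k : ℤ => (⌊funG L k - funF m k⌋ : ℝ)) hsub fun k hk _ => by
      have hk0 : (0 : ℝ) ≤ k := by exact_mod_cast (Finset.mem_Ioo.1 hk).1.le
      exact_mod_cast Int.floor_nonneg.2
        (sub_nonneg.2 (funF_le_funG hk0 hm (hmM.trans (hMl.trans hlL))))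
  linarith [key 0 le_rfl]

theorem latticeP_monotone_spread (lam₀ mu₀ : ℝ) (hmu₀ : 0 < mu₀) (hml : mu₀ < lam₀) :
    (funP lam₀ mu₀ = 0 →
      ∀ lam mu : ℝ, 0 < lam → lam ≤ lam₀ → mu₀ ≤ mu → mu < lam →
        funP lam mu < (lam ^ 2 - mu ^ 2) / 4) ∧
    ((lam₀ ^ 2 - mu₀ ^ 2) / 4 - funP lam₀ mu₀ > 0 →
      ∀ lam mu : ℝ,
        Real.sqrt (mu₀ ^ 2 + 4 * funP lam₀ mu₀) < lam → lam ≤ lam₀ →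
        mu₀ ≤ mu → mu < Real.sqrt (lam ^ 2 - 4 * funP lam₀ mu₀) →
        funP lam mu < (lam ^ 2 - mu ^ 2) / 4) := by
  refine ⟨fun hp lam mu _ hlam hmu hlt => ?_, fun _ lam mu hlam₁ hlam hmu hlt => ?_⟩
  · have h := funP_le_funP hmu₀ hmu hlt.le hlam
    rw [hp] at h
    nlinarith
  · have hp := funP_nonneg hmu₀ hml.le
    have hmu_pos := hmu₀.trans_le hmu
    have hlam_pos := (Real.sqrt_nonneg _).trans_lt hlam₁
    have hsq := (Real.lt_sqrt hmu_pos.le).1 hlt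
    have hmu_lt : mu < lam := lt_of_pow_lt_pow_left₀ 2 hlam_pos.le (by linarith)
    linarith [funP_le_funP hmu₀ hmu hmu_lt.le hlam]
end
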